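/- arXiv:1311.0155 — 4 statements merged into one kernel-verified Lean document; each statement's English description precedes it below -/
import Mathlib

section
/- Let I : (0,1] → (0,∞) be nondecreasing with inf_{t∈(0,1]} I(t)/t > 0, let m ≥ 1 be an integer, and let f : (0,1) → [0,∞) be measurable and nonincreasing. Then for every s ∈ (0,1), S^m_I f(s) ≤ 2^m (m−1)! · R^m_I f(s), and for every a ∈ (0,1), sup_{s∈(0,a)} R^m_I f(s) ≤ (m^{m−1}/(m−1)!) · sup_{s∈(0,a)} S^m_I f(s). In particular, sup_{s∈(0,a)} R^m_I f(s) and sup_{s∈(0,a)} S^m_I f(s) are equivalent up to multiplicative constants depending only on m. -/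
open MeasureTheory Set Filter
open scoped ENNReal

/-- The operator `R^m_I f(s) = (1/((m-1)! I(s))) ∫_0^s (∫_t^s dr/I(r))^{m-1} |f(t)| dt`,
with integrals taken in the extended-real sense. -/
noncomputable def opRE (I : ℝ → ℝ) (m : ℕ) (f : ℝ → ℝ) (s : ℝ) : ℝ≥0∞ :=
  (Nat.factorial (m - 1) : ℝ≥0∞)⁻¹ * (ENNReal.ofReal (I s))⁻¹ *
    ∫⁻ t in Set.Ioo 0 s,
      (∫⁻ r in Set.Ioo t s, (ENNReal.ofReal (I r))⁻¹) ^ (m - 1) * ENNReal.ofReal |f t|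

/-- The operator `S^m_I f(s) = (s^{m-1}/I(s)^m) ∫_0^s |f(t)| dt`,
with the integral taken in the extended-real sense. -/
noncomputable def opSE (I : ℝ → ℝ) (m : ℕ) (f : ℝ → ℝ) (s : ℝ) : ℝ≥0∞ :=
  ENNReal.ofReal (s ^ (m - 1) / I s ^ m) * ∫⁻ t in Set.Ioo 0 s, ENNReal.ofReal |f t|

/-- Minkowski's integral inequality, assuming that the left-hand side is finite. -/
theorem lintegral_lintegral_rpow_le_of_ne_top {α β : Type*} [MeasurableSpace α]
    [MeasurableSpace β] {μ : Measure α} {ν : Measure β} [SFinite μ] [SFinite ν] {p : ℝ}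
    (hp : 1 ≤ p) {K : α → β → ℝ≥0∞} (hK : Measurable (Function.uncurry K))
    (hJ : ∫⁻ x, (∫⁻ y, K x y ∂ν) ^ p ∂μ ≠ ∞) :
    ∫⁻ x, (∫⁻ y, K x y ∂ν) ^ p ∂μ ≤ (∫⁻ y, (∫⁻ x, K x y ^ p ∂μ) ^ (1 / p) ∂ν) ^ p := by
  have hp0 : 0 < p := by linarith
  set h : α → ℝ≥0∞ := fun x => ∫⁻ y, K x y ∂ν
  have hhm : Measurable h := hK.lintegral_prod_right'
  set J := ∫⁻ x, h x ^ p ∂μ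
  set B := ∫⁻ y, (∫⁻ x, K x y ^ p ∂μ) ^ (1 / p) ∂ν
  rcases eq_or_ne J 0 with h0 | h0
  · rw [h0]; exact zero_le
  have hq : 0 ≤ (p - 1) / p := div_nonneg (by linarith) hp0.le
  have hsum : (p - 1) / p + 1 / p = 1 := by field_simp; ring
  have key : J ≤ J ^ ((p - 1) / p) * B := by
    calc J = ∫⁻ x, ∫⁻ y, h x ^ (p - 1) * K x y ∂ν ∂μ := by
          refine lintegral_congr fun x => ?_
          rw [lintegral_const_mul _ (show Measurable (K x) from hK.comp measurable_prodMk_left)]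
          change _ = h x ^ (p - 1) * h x
          nth_rewrite 3 [← ENNReal.rpow_one (h x)]
          rw [← ENNReal.rpow_add_of_nonneg _ _ (by linarith) zero_le_one, sub_add_cancel]
      _ = ∫⁻ y, ∫⁻ x, h x ^ (p - 1) * K x y ∂μ ∂ν := by
          refine lintegral_lintegral_swap (Measurable.aemeasurable ?_)
          exact ((hhm.comp measurable_fst).pow_const _).mul hK
      _ ≤ ∫⁻ y, J ^ ((p - 1) / p) * (∫⁻ x, K x y ^ p ∂μ) ^ (1 / p) ∂ν := by
          refine lintegral_mono fun y => ?_
          have := ENNReal.lintegral_mul_norm_pow_le (μ := μ) (f := fun x => h x ^ p)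
            (g := fun x => K x y ^ p) (hhm.pow_const _).aemeasurable
            ((hK.comp measurable_prodMk_right).pow_const _).aemeasurable hq (by positivity) hsum
          refine le_trans (le_of_eq (lintegral_congr fun x => ?_)) this
          rw [← ENNReal.rpow_mul, ← ENNReal.rpow_mul, mul_div_cancel₀ _ hp0.ne',
            mul_one_div_cancel hp0.ne', ENNReal.rpow_one]
      _ = J ^ ((p - 1) / p) * B := by
          refine lintegral_const_mul _ (Measurable.pow_const ?_ _)
          exact Measurable.lintegral_prod_left (hK.pow_const p)
  have hJB : J ^ (1 / p) ≤ B := by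
    have hne : J ^ ((p - 1) / p) ≠ 0 := by simp [ENNReal.rpow_eq_zero_iff, h0, hJ]
    have hnt : J ^ ((p - 1) / p) ≠ ∞ := ENNReal.rpow_ne_top_of_nonneg hq hJ
    rw [← ENNReal.mul_le_mul_iff_right hne hnt, ← ENNReal.rpow_add_of_nonneg _ _ hq (by positivity),
      hsum, ENNReal.rpow_one]
    exact key
  calc J = (J ^ (1 / p)) ^ p := by
        rw [← ENNReal.rpow_mul, one_div_mul_cancel hp0.ne', ENNReal.rpow_one]
    _ ≤ B ^ p := ENNReal.rpow_le_rpow hJB hp0.le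

/-- Minkowski's integral inequality over a finite measure, for a kernel with almost everywhere
finite partial integrals. -/
theorem lintegral_lintegral_rpow_le {α β : Type*} [MeasurableSpace α]
    [MeasurableSpace β] {μ : Measure α} {ν : Measure β} [IsFiniteMeasure μ] [SFinite ν] {p : ℝ}
    (hp : 1 ≤ p) {K : α → β → ℝ≥0∞} (hK : Measurable (Function.uncurry K))
    (hfin : ∀ᵐ x ∂μ, ∫⁻ y, K x y ∂ν ≠ ∞) :
    ∫⁻ x, (∫⁻ y, K x y ∂ν) ^ p ∂μ ≤ (∫⁻ y, (∫⁻ x, K x y ^ p ∂μ) ^ (1 / p) ∂ν) ^ p := by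
  have hp0 : 0 < p := by linarith
  set h : α → ℝ≥0∞ := fun x => ∫⁻ y, K x y ∂ν
  have hhm : Measurable h := hK.lintegral_prod_right'
  let A : ℕ → Set α := fun n => {x | h x ≤ n}
  have hAmono : Monotone A := fun m n hmn x hx =>
    le_trans (show h x ≤ m from hx) (by exact_mod_cast hmn)
  have hAuniv : μ.restrict (⋃ n, A n) = μ := by
    refine Measure.restrict_eq_self_of_ae_mem ?_
    filter_upwards [hfin] with x hx
    obtain ⟨n, hn⟩ := ENNReal.exists_nat_gt hx
    exact mem_iUnion.2 ⟨n, hn.le⟩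
  conv_lhs => rw [← hAuniv]
  rw [setLIntegral_iUnion_of_directed _ hAmono.directed_le]
  refine iSup_le fun n => ?_
  have hlt : ∫⁻ x in A n, h x ^ p ∂μ ≠ ∞ := by
    refine ne_top_of_le_ne_top ?_ (setLIntegral_mono (g := fun _ => (n : ℝ≥0∞) ^ p)
      measurable_const fun x hx => ENNReal.rpow_le_rpow hx hp0.le)
    rw [lintegral_const]
    exact ENNReal.mul_ne_top (ENNReal.rpow_ne_top_of_nonneg hp0.le (ENNReal.natCast_ne_top n))
      (measure_ne_top _ _)
  refine (lintegral_lintegral_rpow_le_of_ne_top hp hK hlt).trans ?_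
  gcongr
  exact Measure.restrict_le_self

/-- On the first half of an interval, a nonincreasing function carries at least half of its
integral. -/
theorem AntitoneOn.setLIntegral_Ioo_le_two_mul {F : ℝ → ℝ≥0∞} {s : ℝ} (hs : 0 < s)
    (hF : AntitoneOn F (Ioo 0 s)) :
    ∫⁻ t in Ioo 0 s, F t ≤ 2 * ∫⁻ t in Ioo 0 (s / 2), F t := by
  have hhalf : s / 2 ∈ Ioo 0 s := ⟨by linarith, by linarith⟩
  have hsplit : Ioo 0 s = Ioo 0 (s / 2) ∪ Ico (s / 2) s :=
    (Ioo_union_Ico_eq_Ioo hhalf.1 hhalf.2.le).symm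
  have hright : ∫⁻ t in Ico (s / 2) s, F t ≤ F (s / 2) * ENNReal.ofReal (s / 2) := by
    refine (setLIntegral_mono (g := fun _ => F (s / 2)) measurable_const fun t ht =>
      hF hhalf ⟨hhalf.1.trans_le ht.1, ht.2⟩ ht.1).trans (le_of_eq ?_)
    rw [setLIntegral_const, Real.volume_Ico, sub_half]
  have hleft : F (s / 2) * ENNReal.ofReal (s / 2) ≤ ∫⁻ t in Ioo 0 (s / 2), F t := by
    refine le_trans (le_of_eq ?_) (setLIntegral_mono' (f := fun _ => F (s / 2)) measurableSet_Ioo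
      fun t ht => hF ⟨ht.1, ht.2.trans hhalf.2⟩ hhalf ht.2.le)
    rw [setLIntegral_const, Real.volume_Ioo, sub_zero]
  rw [hsplit, two_mul]
  exact (lintegral_union_le _ _ _).trans (add_le_add le_rfl (hright.trans hleft))

/-- The integral of a power function over `(0, s)`, in the extended-real sense. -/
theorem setLIntegral_Ioo_rpow {s p : ℝ} (hs : 0 ≤ s) (hp : -1 < p) :
    ∫⁻ r in Ioo 0 s, ENNReal.ofReal r ^ p = ENNReal.ofReal (s ^ (p + 1) / (p + 1)) := by
  have hint := (intervalIntegrable_iff_integrableOn_Ioo_of_le hs).1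
    (intervalIntegral.intervalIntegrable_rpow' (a := 0) (b := s) hp)
  have h := ofReal_integral_eq_lintegral_ofReal hint
    ((ae_restrict_mem measurableSet_Ioo).mono fun r hr => Real.rpow_nonneg hr.1.le p)
  rw [← integral_Ioc_eq_integral_Ioo, ← intervalIntegral.integral_of_le hs,
    integral_rpow (Or.inl hp), Real.zero_rpow (by linarith), sub_zero] at h
  rw [h]
  exact setLIntegral_congr_fun measurableSet_Ioo fun r hr => ENNReal.ofReal_rpow_of_pos hr.1

/-- A weighted Hardy-type inequality for powers of the primitive of a kernel `g` satisfying
`r ^ k * g r ^ (k + 1) * ∫₀ʳ φ ≤ M`. -/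
theorem setLIntegral_Ioo_pow_mul_le {g φ : ℝ → ℝ≥0∞} {s : ℝ} {M : ℝ≥0∞} {k : ℕ} (hk : k ≠ 0)
    (hs : 0 < s) (hg : AEMeasurable g (volume.restrict (Ioo 0 s)))
    (hgfin : ∀ t ∈ Ioo 0 s, ∫⁻ r in Ioo t s, g r ≠ ∞)
    (hφ : AEMeasurable φ (volume.restrict (Ioo 0 s)))
    (hφfin : ∫⁻ t in Ioo 0 s, φ t ≠ ∞)
    (hM : ∀ r ∈ Ioo 0 s, ENNReal.ofReal r ^ k * g r ^ (k + 1) * ∫⁻ t in Ioo 0 r, φ t ≤ M) :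
    ∫⁻ t in Ioo 0 s, (∫⁻ r in Ioo t s, g r) ^ k * φ t ≤
      ((k + 1 : ℕ) : ℝ≥0∞) ^ k *
        (M ^ k * ENNReal.ofReal s ^ k * ∫⁻ t in Ioo 0 s, φ t) ^ (1 / (k + 1) : ℝ) := by
  set F : ℝ → ℝ≥0∞ := fun r => ∫⁻ t in Ioo 0 r, φ t
  set q : ℝ := 1 / (k + 1) with hq
  have hk0 : (0 : ℝ) < k := by exact_mod_cast Nat.pos_of_ne_zero hk
  have hk1 : (1 : ℝ) ≤ k := by exact_mod_cast Nat.one_le_iff_ne_zero.2 hk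
  have hq0 : 0 < q := by positivity
  have hqk : -(k * q) + 1 = q := by rw [hq]; field_simp; ring
  have hqle : 0 ≤ 1 / k - q := by
    rw [hq, sub_nonneg]; exact one_div_le_one_div_of_le hk0 (by linarith)
  set g' := hg.mk g
  have hg'm : Measurable g' := hg.measurable_mk
  have hgg' : g =ᵐ[volume.restrict (Ioo 0 s)] g' := hg.ae_eq_mk
  set ν : Measure ℝ := volume.restrict (Ioo 0 s) with hν
  set μ : Measure ℝ := ν.withDensity φ with hμ
  have : IsFiniteMeasure μ := isFiniteMeasure_withDensity hφfin
  have hacμ : μ ≪ ν := withDensity_absolutelyContinuous _ _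
  set K : ℝ → ℝ → ℝ≥0∞ := fun t r => (Ioi t).indicator g' r
  have hK : Measurable (Function.uncurry K) := by
    have : Function.uncurry K =
        {p : ℝ × ℝ | p.1 < p.2}.indicator (fun p => g' p.2) := by
      ext ⟨t, r⟩; simp [K, indicator]
    rw [this]
    exact (hg'm.comp measurable_snd).indicator (measurableSet_lt measurable_fst measurable_snd)
  have hKint : ∀ t ∈ Ioo 0 s, ∫⁻ r, K t r ∂ν = ∫⁻ r in Ioo t s, g r := by
    intro t ht
    have hset : Ioi t ∩ Ioo 0 s = Ioo t s := by
      ext r; simp only [mem_inter_iff, mem_Ioi, mem_Ioo]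
      exact ⟨fun h => ⟨h.1, h.2.2⟩, fun h => ⟨h.1, ht.1.trans h.1, h.2⟩⟩
    rw [lintegral_indicator measurableSet_Ioi, hν, Measure.restrict_restrict measurableSet_Ioi,
      hset]
    exact (lintegral_congr_ae
      (ae_restrict_of_ae_restrict_of_subset (Ioo_subset_Ioo_left ht.1.le) hgg')).symm
  have hμIio : ∀ r ∈ Ioo 0 s, μ (Iio r) = F r := by
    intro r hr
    have hset : Iio r ∩ Ioo 0 s = Ioo 0 r := by
      ext t; simp only [mem_inter_iff, mem_Iio, mem_Ioo]
      exact ⟨fun h => ⟨h.2.1, h.1⟩, fun h => ⟨h.2, h.1, h.2.trans hr.2⟩⟩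
    rw [hμ, withDensity_apply _ measurableSet_Iio, hν,
      Measure.restrict_restrict measurableSet_Iio, hset]
  have hKpow : ∀ r ∈ Ioo 0 s, (∫⁻ t, K t r ^ (k : ℝ) ∂μ) ^ (1 / k : ℝ) =
      g' r * F r ^ (1 / k : ℝ) := by
    intro r hr
    have : ∀ t, K t r ^ (k : ℝ) = (Iio r).indicator (fun _ => g' r ^ (k : ℝ)) t := by
      intro t
      by_cases h : t < r <;> simp [K, indicator, h, hk]
    simp_rw [this]
    rw [lintegral_indicator_const measurableSet_Iio, hμIio r hr,
      ENNReal.mul_rpow_of_nonneg _ _ (by positivity), ← ENNReal.rpow_mul,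
      mul_one_div_cancel hk0.ne', ENNReal.rpow_one]
  have hpt : ∀ r ∈ Ioo 0 s, g r * F r ^ (1 / k : ℝ) ≤
      M ^ q * F s ^ (1 / k - q) * ENNReal.ofReal r ^ (-(k * q)) := by
    intro r hr
    have hr0 : ENNReal.ofReal r ≠ 0 := by simpa using hr.1
    have h1 : ENNReal.ofReal r ^ (k * q) * (g r * F r ^ q) ≤ M ^ q := by
      refine le_trans (le_of_eq ?_) (ENNReal.rpow_le_rpow (hM r hr) hq0.le)
      rw [ENNReal.mul_rpow_of_nonneg _ _ hq0.le, ENNReal.mul_rpow_of_nonneg _ _ hq0.le,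
        ← ENNReal.rpow_natCast, ← ENNReal.rpow_natCast, ← ENNReal.rpow_mul, ← ENNReal.rpow_mul]
      have : ((k + 1 : ℕ) : ℝ) * q = 1 := by rw [hq]; push_cast; field_simp
      rw [this, ENNReal.rpow_one, mul_assoc]
    have h2 : g r * F r ^ q ≤ M ^ q * ENNReal.ofReal r ^ (-(k * q)) := by
      rw [ENNReal.rpow_neg, ← div_eq_mul_inv]
      refine (ENNReal.le_div_iff_mul_le (Or.inl ?_) (Or.inl ?_)).2 (by rwa [mul_comm])
      · simp [ENNReal.rpow_eq_zero_iff, hr.1]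
      · exact ENNReal.rpow_ne_top_of_nonneg (by positivity) ENNReal.ofReal_ne_top
    have h3 : F r ≤ F s := lintegral_mono_set (Ioo_subset_Ioo_right hr.2.le)
    calc g r * F r ^ (1 / k : ℝ) = (g r * F r ^ q) * F r ^ (1 / k - q) := by
          rw [mul_assoc, ← ENNReal.rpow_add_of_nonneg _ _ hq0.le hqle, add_sub_cancel]
      _ ≤ (M ^ q * ENNReal.ofReal r ^ (-(k * q))) * F s ^ (1 / k - q) := by gcongr
      _ = _ := by ring
  have hB : ∫⁻ r, (∫⁻ t, K t r ^ (k : ℝ) ∂μ) ^ (1 / k : ℝ) ∂ν ≤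
      M ^ q * F s ^ (1 / k - q) * ENNReal.ofReal (s ^ q / q) := by
    calc _ ≤ ∫⁻ r in Ioo 0 s, M ^ q * F s ^ (1 / k - q) * ENNReal.ofReal r ^ (-(k * q)) := by
          refine lintegral_mono_ae ?_
          filter_upwards [hgg', ae_restrict_mem measurableSet_Ioo] with r hr hrs
          rw [hKpow r hrs, ← hr]
          exact hpt r hrs
      _ = _ := by
          rw [lintegral_const_mul _ (ENNReal.measurable_ofReal.pow_const _),
            setLIntegral_Ioo_rpow hs.le (by linarith), hqk]
  have hmink := lintegral_lintegral_rpow_le (μ := μ) (ν := ν) hk1 hK (by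
    filter_upwards [hacμ.ae_le (ae_restrict_mem measurableSet_Ioo)] with t ht
    rw [hKint t ht]
    exact hgfin t ht)
  have hlhs : ∫⁻ t, (∫⁻ r, K t r ∂ν) ^ (k : ℝ) ∂μ =
      ∫⁻ t in Ioo 0 s, (∫⁻ r in Ioo t s, g r) ^ k * φ t := by
    have hm : Measurable fun t => (∫⁻ r, K t r ∂ν) ^ (k : ℝ) :=
      (Measurable.lintegral_prod_right' hK).pow_const _
    rw [hμ, lintegral_withDensity_eq_lintegral_mul₀ hφ hm.aemeasurable]
    refine setLIntegral_congr_fun measurableSet_Ioo fun t ht => ?_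
    simp only [Pi.mul_apply]
    rw [hKint t ht, ENNReal.rpow_natCast, mul_comm]
  rw [← hlhs]
  refine hmink.trans ((ENNReal.rpow_le_rpow hB hk0.le).trans (le_of_eq ?_))
  have hsq : ENNReal.ofReal (s ^ q / q) = ((k + 1 : ℕ) : ℝ≥0∞) * ENNReal.ofReal s ^ q := by
    rw [ENNReal.ofReal_rpow_of_pos hs, ← ENNReal.ofReal_natCast,
      ← ENNReal.ofReal_mul (by positivity), hq]
    congr 1
    push_cast
    field_simp
  rw [hsq]
  simp only [ENNReal.mul_rpow_of_nonneg _ _ hk0.le, ENNReal.mul_rpow_of_nonneg _ _ hq0.le,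
    ← ENNReal.rpow_natCast, ← ENNReal.rpow_mul]
  have hFexp : (1 / (k : ℝ) - q) * k = q := by
    rw [sub_mul, one_div_mul_cancel hk0.ne']; linarith
  rw [hFexp, mul_comm q]
  ring

theorem opSE_succ {I : ℝ → ℝ} {s : ℝ} (hs : 0 ≤ s) (hIs : 0 < I s) (k : ℕ) (f : ℝ → ℝ) :
    opSE I (k + 1) f s = ENNReal.ofReal s ^ k * (ENNReal.ofReal (I s))⁻¹ ^ (k + 1) *
      ∫⁻ t in Ioo 0 s, ENNReal.ofReal |f t| := by
  rw [opSE, Nat.add_sub_cancel, ENNReal.ofReal_div_of_pos (pow_pos hIs _),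
    ENNReal.ofReal_pow hs, ENNReal.ofReal_pow hIs.le, div_eq_mul_inv, ENNReal.inv_pow]

/-- The pointwise bound of `opSE` by `opRE` for a nonincreasing function. -/
theorem opSE_le_opRE {I : ℝ → ℝ} {s : ℝ} (hs : 0 < s) (hImono : MonotoneOn I (Ioc 0 s))
    (hIs : 0 < I s) (k : ℕ) {f : ℝ → ℝ}
    (hf : AntitoneOn (fun t => ENNReal.ofReal |f t|) (Ioo 0 s)) :
    opSE I (k + 1) f s ≤ 2 ^ (k + 1) * (k.factorial : ℝ≥0∞) * opRE I (k + 1) f s := by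
  rw [opSE_succ hs.le hIs, opRE, Nat.add_sub_cancel]
  set g : ℝ → ℝ≥0∞ := fun r => (ENNReal.ofReal (I r))⁻¹ with hg
  change ENNReal.ofReal s ^ k * g s ^ (k + 1) * _ ≤ _ * ((k.factorial : ℝ≥0∞)⁻¹ * g s * _)
  have hinner : ∀ t ∈ Ioo 0 (s / 2), g s * ENNReal.ofReal (s / 2) ≤ ∫⁻ r in Ioo t s, g r := by
    intro t ht
    calc g s * ENNReal.ofReal (s / 2) ≤ g s * ENNReal.ofReal (s - t) := by
          gcongr; linarith [ht.2]
      _ = ∫⁻ _ in Ioo t s, g s := by rw [setLIntegral_const, Real.volume_Ioo]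
      _ ≤ _ := setLIntegral_mono' measurableSet_Ioo fun r hr => ENNReal.inv_le_inv.2
          (ENNReal.ofReal_le_ofReal (hImono ⟨ht.1.trans hr.1, hr.2.le⟩ ⟨hs, le_rfl⟩ hr.2.le))
  have houter : (g s * ENNReal.ofReal (s / 2)) ^ k * ∫⁻ t in Ioo 0 (s / 2), ENNReal.ofReal |f t| ≤
      ∫⁻ t in Ioo 0 s, (∫⁻ r in Ioo t s, g r) ^ k * ENNReal.ofReal |f t| := by
    refine (lintegral_const_mul_le _ _).trans
      ((setLIntegral_mono' measurableSet_Ioo fun t ht => ?_).trans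
        (lintegral_mono_set (Ioo_subset_Ioo_right (by linarith))))
    gcongr
    exact hinner t ht
  have hs2 : ENNReal.ofReal s = 2 * ENNReal.ofReal (s / 2) := by
    rw [← ENNReal.ofReal_ofNat 2, ← ENNReal.ofReal_mul zero_le_two, mul_div_cancel₀ _ two_ne_zero]
  have hfact : (k.factorial : ℝ≥0∞) * (k.factorial : ℝ≥0∞)⁻¹ = 1 :=
    ENNReal.mul_inv_cancel (by exact_mod_cast k.factorial_ne_zero) (ENNReal.natCast_ne_top _)
  calc _ ≤ ENNReal.ofReal s ^ k * g s ^ (k + 1) *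
          (2 * ∫⁻ t in Ioo 0 (s / 2), ENNReal.ofReal |f t|) := by
        gcongr; exact hf.setLIntegral_Ioo_le_two_mul hs
    _ = 2 ^ (k + 1) * 1 * g s * ((g s * ENNReal.ofReal (s / 2)) ^ k *
          ∫⁻ t in Ioo 0 (s / 2), ENNReal.ofReal |f t|) := by rw [hs2]; ring
    _ ≤ 2 ^ (k + 1) * 1 * g s *
          ∫⁻ t in Ioo 0 s, (∫⁻ r in Ioo t s, g r) ^ k * ENNReal.ofReal |f t| := by gcongr
    _ = _ := by rw [← hfact]; ring

/-- A bound for `opSE` on `(0, s]` controls `opRE` at `s`. -/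
theorem opRE_le_of_opSE_le {I : ℝ → ℝ} {s : ℝ} (hs : 0 < s) (hImono : MonotoneOn I (Ioc 0 s))
    (hIpos : ∀ t ∈ Ioc 0 s, 0 < I t) (k : ℕ) {f : ℝ → ℝ}
    (hf : AEMeasurable f (volume.restrict (Ioo 0 s))) {M : ℝ≥0∞}
    (hM : ∀ r ∈ Ioc 0 s, opSE I (k + 1) f r ≤ M) :
    opRE I (k + 1) f s ≤ ((k + 1 : ℕ) : ℝ≥0∞) ^ k / (k.factorial : ℝ≥0∞) * M := by
  have hss : s ∈ Ioc 0 s := ⟨hs, le_rfl⟩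
  have hM' : ∀ r ∈ Ioc 0 s, ENNReal.ofReal r ^ k * (ENNReal.ofReal (I r))⁻¹ ^ (k + 1) *
      ∫⁻ t in Ioo 0 r, ENNReal.ofReal |f t| ≤ M := fun r hr => by
    rw [← opSE_succ hr.1.le (hIpos r hr)]; exact hM r hr
  rw [opRE, Nat.add_sub_cancel, div_eq_mul_inv, mul_assoc,
    mul_comm (((k + 1 : ℕ) : ℝ≥0∞) ^ k), mul_assoc]
  refine mul_le_mul_right ?_ _
  set g : ℝ → ℝ≥0∞ := fun r => (ENNReal.ofReal (I r))⁻¹ with hg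
  change g s * _ ≤ _
  rcases eq_or_ne k 0 with rfl | hk
  · simpa using hM' s hss
  rcases eq_or_ne M ∞ with rfl | hMtop
  · simp [ENNReal.mul_top]
  have hgs0 : g s ≠ 0 := by simp [hg]
  have hgtop : ∀ t ∈ Ioc 0 s, g t ≠ ∞ := fun t ht => by simpa [hg] using hIpos t ht
  have hganti : AntitoneOn g (Ioc 0 s) := fun x hx y hy hxy =>
    ENNReal.inv_le_inv.2 (ENNReal.ofReal_le_ofReal (hImono hx hy hxy))
  have hgm : AEMeasurable g (volume.restrict (Ioo 0 s)) :=
    aemeasurable_restrict_of_antitoneOn measurableSet_Ioo (hganti.mono Ioo_subset_Ioc_self)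
  have hgfin : ∀ t ∈ Ioo 0 s, ∫⁻ r in Ioo t s, g r ≠ ∞ := by
    intro t ht
    have ht' : t ∈ Ioc 0 s := ⟨ht.1, ht.2.le⟩
    refine ne_top_of_le_ne_top ?_ (setLIntegral_mono (g := fun _ => g t) measurable_const
      fun r hr => hganti ht' ⟨ht.1.trans hr.1, hr.2.le⟩ hr.1.le)
    rw [setLIntegral_const, Real.volume_Ioo]
    exact ENNReal.mul_ne_top (hgtop t ht') ENNReal.ofReal_ne_top
  have hFfin : ∫⁻ t in Ioo 0 s, ENNReal.ofReal |f t| ≠ ∞ := by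
    intro h
    refine hMtop (top_le_iff.1 (le_trans (le_of_eq ?_) (hM' s hss)))
    rw [h, ENNReal.mul_top]
    exact mul_ne_zero (pow_ne_zero _ (by simpa using hs)) (pow_ne_zero _ hgs0)
  have hφ : AEMeasurable (fun t => ENNReal.ofReal |f t|) (volume.restrict (Ioo 0 s)) :=
    (measurable_norm.comp_aemeasurable hf).ennreal_ofReal
  have hk1 : (0 : ℝ) < k + 1 := by positivity
  have hroot : ∀ x : ℝ≥0∞, (x ^ (k + 1)) ^ (1 / (k + 1) : ℝ) = x := fun x => by
    rw [← ENNReal.rpow_natCast, ← ENNReal.rpow_mul]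
    push_cast
    rw [mul_one_div_cancel hk1.ne', ENNReal.rpow_one]
  set F := ∫⁻ t in Ioo 0 s, ENNReal.ofReal |f t|
  calc g s * ∫⁻ t in Ioo 0 s, (∫⁻ r in Ioo t s, g r) ^ k * ENNReal.ofReal |f t|
      ≤ g s * (((k + 1 : ℕ) : ℝ≥0∞) ^ k *
          (M ^ k * ENNReal.ofReal s ^ k * F) ^ (1 / (k + 1) : ℝ)) := by
        gcongr
        exact setLIntegral_Ioo_pow_mul_le hk hs hgm hgfin hφ hFfin
          fun r hr => hM' r ⟨hr.1, hr.2.le⟩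
    _ = ((k + 1 : ℕ) : ℝ≥0∞) ^ k *
          (M ^ k * (ENNReal.ofReal s ^ k * g s ^ (k + 1) * F)) ^ (1 / (k + 1) : ℝ) := by
        conv_lhs => rw [← hroot (g s)]
        rw [mul_left_comm, ← ENNReal.mul_rpow_of_nonneg _ _ (by positivity)]
        congr 2
        ring
    _ ≤ ((k + 1 : ℕ) : ℝ≥0∞) ^ k * (M ^ k * M) ^ (1 / (k + 1) : ℝ) := by
        gcongr
        exact hM' s hss
    _ = ((k + 1 : ℕ) : ℝ≥0∞) ^ k * M := by rw [← pow_succ, hroot]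

/-- For nondecreasing `I` and nonincreasing nonnegative `f`:
`S^m_I f(s) ≤ 2^m (m-1)! R^m_I f(s)` for every `s ∈ (0,1)`, and
`sup_{s∈(0,a)} R^m_I f(s) ≤ (m^{m-1}/(m-1)!) sup_{s∈(0,a)} S^m_I f(s)` for every `a ∈ (0,1)`. -/
theorem RS_equivalence_for_nonincreasing
    (I : ℝ → ℝ)
    (hImono : MonotoneOn I (Set.Ioc (0:ℝ) 1))
    (hIpos : ∀ t ∈ Set.Ioc (0:ℝ) 1, 0 < I t)
    (hIinf : ∃ c : ℝ, 0 < c ∧ ∀ t ∈ Set.Ioc (0:ℝ) 1, c * t ≤ I t)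
    (m : ℕ) (hm : 1 ≤ m)
    (f : ℝ → ℝ)
    (hfmeas : AEMeasurable f (MeasureTheory.volume.restrict (Set.Ioo (0:ℝ) 1)))
    (hf0 : ∀ t ∈ Set.Ioo (0:ℝ) 1, 0 ≤ f t)
    (hfanti : AntitoneOn f (Set.Ioo (0:ℝ) 1)) :
    (∀ s ∈ Set.Ioo (0:ℝ) 1,
      opSE I m f s ≤ (2:ℝ≥0∞) ^ m * (Nat.factorial (m - 1) : ℝ≥0∞) * opRE I m f s) ∧
    (∀ a ∈ Set.Ioo (0:ℝ) 1,
      (⨆ s ∈ Set.Ioo (0:ℝ) a, opRE I m f s) ≤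
        ((m : ℝ≥0∞) ^ (m - 1) / (Nat.factorial (m - 1) : ℝ≥0∞)) *
          ⨆ s ∈ Set.Ioo (0:ℝ) a, opSE I m f s) := by
  obtain ⟨k, rfl⟩ : ∃ k, m = k + 1 := ⟨m - 1, by omega⟩
  rw [Nat.add_sub_cancel]
  have hsub : ∀ s ∈ Ioo (0 : ℝ) 1, Ioc 0 s ⊆ Ioc 0 1 := fun s hs => Ioc_subset_Ioc_right hs.2.le
  refine ⟨fun s hs => ?_, fun a ha => iSup₂_le fun s hs => ?_⟩
  · have hsub' : Ioo 0 s ⊆ Ioo 0 1 := Ioo_subset_Ioo_right hs.2.le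
    refine opSE_le_opRE hs.1 (hImono.mono (hsub s hs)) (hIpos s ⟨hs.1, hs.2.le⟩) k
      fun x hx y hy hxy => ENNReal.ofReal_le_ofReal ?_
    rw [abs_of_nonneg (hf0 x (hsub' hx)), abs_of_nonneg (hf0 y (hsub' hy))]
    exact hfanti (hsub' hx) (hsub' hy) hxy
  · have hs1 : s ∈ Ioo (0 : ℝ) 1 := ⟨hs.1, hs.2.trans ha.2⟩
    exact opRE_le_of_opSE_le hs.1 (hImono.mono (hsub s hs1)) (fun t ht => hIpos t (hsub s hs1 ht)) k
      (hfmeas.mono_set (Ioo_subset_Ioo_right hs1.2.le))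
      fun r hr => le_iSup₂_of_le r ⟨hr.1, hr.2.trans_lt hs.2⟩ le_rfl
end

section
/- Let I : (0,1] → (0,∞) be nondecreasing with inf_{t∈(0,1]} I(t)/t > 0 and ∫_0^1 ds/I(s) < ∞. Let f : (0,1) → [0,∞) be measurable and let g : (0,1) → [0,∞) be measurable, nonincreasing and equimeasurable with f. Then ∫_0^1 g(s)/I(s) ds ≤ sup{ ∫_0^1 h(s)/I(s) ds : h : (0,1) → [0,∞) measurable, h equimeasurable with f } + ∫_0^1 f(s) ds ≤ (1 + I(1)) ∫_0^1 g(s)/I(s) ds. -/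
open MeasureTheory Set Filter
open scoped ENNReal

/-- Two functions on (0,1) are equimeasurable: for every `λ > 0` their level sets
`{t ∈ (0,1) : u(t) > λ}` and `{t ∈ (0,1) : v(t) > λ}` have equal Lebesgue measure. -/
def EquiMeas (u v : ℝ → ℝ) : Prop :=
  ∀ lam : ℝ, 0 < lam →
    MeasureTheory.volume {t | t ∈ Set.Ioo (0:ℝ) 1 ∧ lam < u t} =
      MeasureTheory.volume {t | t ∈ Set.Ioo (0:ℝ) 1 ∧ lam < v t}

/-- Among sets of a given finite measure, one whose density values dominate those off the set
maximizes the weighted measure. -/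
theorem withDensity_le_of_measure_eq {α : Type*} [MeasurableSpace α] {μ : Measure α}
    {w : α → ℝ≥0∞} {A B : Set α} {c : ℝ≥0∞}
    (hA : NullMeasurableSet A μ) (hB : NullMeasurableSet B μ) (hAB : μ A = μ B)
    (hfin : μ A ≠ ⊤) (hout : ∀ᵐ x ∂μ, x ∉ B → w x ≤ c) (hin : ∀ᵐ x ∂μ, x ∈ B → c ≤ w x) :
    μ.withDensity w A ≤ μ.withDensity w B := by
  have hac := withDensity_absolutelyContinuous μ w
  have hdiff : μ (A \ B) = μ (B \ A) := by
    have h1 := measure_inter_add_sdiff₀ A hB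
    have h2 := measure_inter_add_sdiff₀ B hA
    rw [inter_comm] at h2
    have hfin' : μ (A ∩ B) ≠ ⊤ := ne_top_of_le_ne_top hfin (measure_mono inter_subset_left)
    exact (ENNReal.add_right_inj hfin').1 (h1.trans (hAB.trans h2.symm))
  rw [← measure_inter_add_sdiff₀ A (hB.mono_ac hac), ← measure_inter_add_sdiff₀ B (hA.mono_ac hac),
    inter_comm B A]
  refine add_le_add le_rfl ?_
  rw [withDensity_apply₀ w (hA.diff hB), withDensity_apply₀ w (hB.diff hA)]
  calc ∫⁻ x in A \ B, w x ∂μ ≤ ∫⁻ _ in A \ B, c ∂μ := by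
        refine setLIntegral_mono_ae aemeasurable_const ?_
        filter_upwards [hout] with x hx hxA using hx hxA.2
    _ = ∫⁻ _ in B \ A, c ∂μ := by rw [setLIntegral_const, setLIntegral_const, hdiff]
    _ ≤ ∫⁻ x in B \ A, w x ∂μ := by
        refine lintegral_mono_ae ((ae_restrict_iff'₀ (hB.diff hA)).2 ?_)
        filter_upwards [hin] with x hx hxB using hx hxB.1

theorem lintegral_ofReal_mul_eq_lintegral_withDensity_lt {α : Type*} [MeasurableSpace α]
    {μ : Measure α} {w : α → ℝ≥0∞} {u : α → ℝ} (hw : AEMeasurable w μ)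
    (hu0 : ∀ᵐ x ∂μ, 0 ≤ u x) (hu : AEMeasurable u μ) :
    ∫⁻ x, ENNReal.ofReal (u x) * w x ∂μ = ∫⁻ t in Ioi 0, μ.withDensity w {x | t < u x} := by
  have hac := withDensity_absolutelyContinuous μ w
  rw [← lintegral_eq_lintegral_meas_lt _ (hac.ae_le hu0) (hu.mono_ac hac),
    lintegral_withDensity_eq_lintegral_mul₀ hw hu.ennreal_ofReal]
  simp only [Pi.mul_apply, mul_comm]

theorem EquiMeas.restrict_eq {u v : ℝ → ℝ} (h : EquiMeas u v) {t : ℝ} (ht : 0 < t) :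
    volume.restrict (Ioo (0 : ℝ) 1) {x | t < u x} =
      volume.restrict (Ioo (0 : ℝ) 1) {x | t < v x} := by
  rw [Measure.restrict_apply' measurableSet_Ioo, Measure.restrict_apply' measurableSet_Ioo,
    inter_comm, inter_comm {x | t < v x}]
  exact h t ht

theorem EquiMeas.lintegral_eq {u v : ℝ → ℝ} (h : EquiMeas u v)
    (hu0 : ∀ t ∈ Ioo (0 : ℝ) 1, 0 ≤ u t) (hv0 : ∀ t ∈ Ioo (0 : ℝ) 1, 0 ≤ v t)
    (hu : AEMeasurable u (volume.restrict (Ioo (0 : ℝ) 1)))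
    (hv : AEMeasurable v (volume.restrict (Ioo (0 : ℝ) 1))) :
    ∫⁻ s in Ioo (0 : ℝ) 1, ENNReal.ofReal (u s) = ∫⁻ s in Ioo (0 : ℝ) 1, ENNReal.ofReal (v s) := by
  rw [lintegral_eq_lintegral_meas_lt _ (ae_restrict_of_forall_mem measurableSet_Ioo hu0) hu,
    lintegral_eq_lintegral_meas_lt _ (ae_restrict_of_forall_mem measurableSet_Ioo hv0) hv]
  exact setLIntegral_congr_fun measurableSet_Ioi fun t ht => h.restrict_eq ht

/-- The Hardy–Littlewood inequality: against a nonincreasing weight, the nonincreasing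
rearrangement has the largest integral. -/
theorem EquiMeas.lintegral_mul_le_of_antitoneOn {h g : ℝ → ℝ} {w : ℝ → ℝ≥0∞} (hhg : EquiMeas h g)
    (hw : AntitoneOn w (Ioo (0 : ℝ) 1)) (hg : AntitoneOn g (Ioo (0 : ℝ) 1))
    (hh0 : ∀ t ∈ Ioo (0 : ℝ) 1, 0 ≤ h t) (hg0 : ∀ t ∈ Ioo (0 : ℝ) 1, 0 ≤ g t)
    (hhm : AEMeasurable h (volume.restrict (Ioo (0 : ℝ) 1))) :
    ∫⁻ s in Ioo (0 : ℝ) 1, ENNReal.ofReal (h s) * w s ≤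
      ∫⁻ s in Ioo (0 : ℝ) 1, ENNReal.ofReal (g s) * w s := by
  have hwm := aemeasurable_restrict_of_antitoneOn (μ := volume) measurableSet_Ioo hw
  have hgm := aemeasurable_restrict_of_antitoneOn (μ := volume) measurableSet_Ioo hg
  rw [lintegral_ofReal_mul_eq_lintegral_withDensity_lt hwm
      (ae_restrict_of_forall_mem measurableSet_Ioo hh0) hhm,
    lintegral_ofReal_mul_eq_lintegral_withDensity_lt hwm
      (ae_restrict_of_forall_mem measurableSet_Ioo hg0) hgm]
  refine setLIntegral_mono' measurableSet_Ioi fun t ht => ?_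
  refine withDensity_le_of_measure_eq (c := ⨆ a ∈ {a | a ∈ Ioo (0 : ℝ) 1 ∧ g a ≤ t}, w a)
    (nullMeasurableSet_lt aemeasurable_const hhm) (nullMeasurableSet_lt aemeasurable_const hgm)
    (hhg.restrict_eq ht) (measure_ne_top _ _)
    (ae_restrict_of_forall_mem measurableSet_Ioo fun x hx hxB => ?_)
    (ae_restrict_of_forall_mem measurableSet_Ioo fun x hx hxB => ?_)
  · exact le_iSup₂_of_le x ⟨hx, not_lt.1 hxB⟩ le_rfl
  · refine iSup₂_le fun a ha => hw hx ha.1 ?_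
    by_contra! hax
    exact absurd (hg ha.1 hx hax.le) (not_le.2 (ha.2.trans_lt hxB))

/-- For nondecreasing `I` with `∫_0^1 ds/I(s) < ∞`, a nonnegative measurable `f` and a
nonnegative nonincreasing `g` equimeasurable with `f`:
`∫_0^1 g/I ≤ sup_{h∼f} ∫_0^1 h/I + ∫_0^1 f ≤ (1+I(1)) ∫_0^1 g/I`. -/
theorem rearranged_weighted_integral_equivalence
    (I : ℝ → ℝ)
    (hImono : MonotoneOn I (Set.Ioc (0:ℝ) 1))
    (hIpos : ∀ t ∈ Set.Ioc (0:ℝ) 1, 0 < I t)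
    (hIinf : ∃ c : ℝ, 0 < c ∧ ∀ t ∈ Set.Ioc (0:ℝ) 1, c * t ≤ I t)
    (hIint : ∫⁻ s in Set.Ioo (0:ℝ) 1, ENNReal.ofReal (1 / I s) < ⊤)
    (f g : ℝ → ℝ)
    (hfmeas : AEMeasurable f (MeasureTheory.volume.restrict (Set.Ioo (0:ℝ) 1)))
    (hf0 : ∀ t ∈ Set.Ioo (0:ℝ) 1, 0 ≤ f t)
    (hgmeas : AEMeasurable g (MeasureTheory.volume.restrict (Set.Ioo (0:ℝ) 1)))
    (hg0 : ∀ t ∈ Set.Ioo (0:ℝ) 1, 0 ≤ g t)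
    (hganti : AntitoneOn g (Set.Ioo (0:ℝ) 1))
    (hequi : EquiMeas g f) :
    (∫⁻ s in Set.Ioo (0:ℝ) 1, ENNReal.ofReal (g s) / ENNReal.ofReal (I s)) ≤
      (⨆ h ∈ {h : ℝ → ℝ | (∀ t ∈ Set.Ioo (0:ℝ) 1, 0 ≤ h t) ∧
          AEMeasurable h (MeasureTheory.volume.restrict (Set.Ioo (0:ℝ) 1)) ∧ EquiMeas h f},
        ∫⁻ s in Set.Ioo (0:ℝ) 1, ENNReal.ofReal (h s) / ENNReal.ofReal (I s)) +
        ∫⁻ s in Set.Ioo (0:ℝ) 1, ENNReal.ofReal (f s) ∧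
    (⨆ h ∈ {h : ℝ → ℝ | (∀ t ∈ Set.Ioo (0:ℝ) 1, 0 ≤ h t) ∧
          AEMeasurable h (MeasureTheory.volume.restrict (Set.Ioo (0:ℝ) 1)) ∧ EquiMeas h f},
        ∫⁻ s in Set.Ioo (0:ℝ) 1, ENNReal.ofReal (h s) / ENNReal.ofReal (I s)) +
        (∫⁻ s in Set.Ioo (0:ℝ) 1, ENNReal.ofReal (f s)) ≤
      (1 + ENNReal.ofReal (I 1)) *
        ∫⁻ s in Set.Ioo (0:ℝ) 1, ENNReal.ofReal (g s) / ENNReal.ofReal (I s) := by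
  have hIo : ∀ t ∈ Ioo (0 : ℝ) 1, t ∈ Ioc (0 : ℝ) 1 := fun t ht => Ioo_subset_Ioc_self ht
  have hw : AntitoneOn (fun s => (ENNReal.ofReal (I s))⁻¹) (Ioo (0 : ℝ) 1) := fun a ha b hb hab =>
    ENNReal.inv_le_inv.2 (ENNReal.ofReal_le_ofReal (hImono (hIo a ha) (hIo b hb) hab))
  refine ⟨le_add_right (le_iSup₂_of_le g ⟨hg0, hgmeas, hequi⟩ le_rfl), ?_⟩
  rw [add_mul, one_mul]
  refine add_le_add (iSup₂_le fun h hh => ?_) ?_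
  · obtain ⟨hh0, hhm, hhf⟩ := hh
    have hhg : EquiMeas h g := fun t ht => (hhf t ht).trans (hequi t ht).symm
    simpa only [div_eq_mul_inv] using
      hhg.lintegral_mul_le_of_antitoneOn hw hganti hh0 hg0 hhm
  · rw [← hequi.lintegral_eq hg0 hf0 hgmeas hfmeas,
      ← lintegral_const_mul' _ _ ENNReal.ofReal_ne_top]
    refine setLIntegral_mono' measurableSet_Ioo fun s hs => ?_
    have hpos := ENNReal.ofReal_pos.2 (hIpos s (hIo s hs))
    rw [← mul_div_assoc, ENNReal.le_div_iff_mul_le (Or.inl hpos.ne')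
      (Or.inl ENNReal.ofReal_ne_top), mul_comm]
    gcongr
    exact hImono (hIo s hs) ⟨one_pos, le_rfl⟩ hs.2.le
end

section
/- Let J : (0,1] → (0,∞) be measurable with inf_{t∈(0,1]} J(t)/t > 0, let j ≥ 1 be an integer and let q ∈ [1,∞]. Then for all nonnegative measurable functions f, g on (0,1), sup{ ‖H^j_J h‖_{L^q(0,1)} : h : (0,1) → [0,∞) measurable, h equimeasurable with f + g } ≤ sup{ ‖H^j_J h‖_{L^q(0,1)} : h ≥ 0 measurable, h equimeasurable with f } + sup{ ‖H^j_J h‖_{L^q(0,1)} : h ≥ 0 measurable, h equimeasurable with g } (all suprema taken in [0,∞]). -/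
open MeasureTheory Set Filter
open scoped ENNReal

/-- The operator `H^j_J f(t) = (1/(j-1)!) ∫_t^1 (|f(s)|/J(s)) (∫_t^s dr/J(r))^{j-1} ds`,
with integrals taken in the extended-real (Lebesgue) sense. -/
noncomputable def opHE (J : ℝ → ℝ) (j : ℕ) (f : ℝ → ℝ) (t : ℝ) : ℝ≥0∞ :=
  (Nat.factorial (j - 1) : ℝ≥0∞)⁻¹ *
    ∫⁻ s in Set.Ioo t 1,
      ENNReal.ofReal |f s| / ENNReal.ofReal (J s) *
        (∫⁻ r in Set.Ioo t s, (ENNReal.ofReal (J r))⁻¹) ^ (j - 1)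

/-- The `L^q(0,1)` norm of an extended-real-valued function, with values in `[0,∞]`. -/
noncomputable def lqNormE (q : ℝ≥0∞) (g : ℝ → ℝ≥0∞) : ℝ≥0∞ :=
  if q = ⊤ then essSup g (MeasureTheory.volume.restrict (Set.Ioo (0:ℝ) 1))
  else (∫⁻ t in Set.Ioo (0:ℝ) 1, g t ^ q.toReal) ^ q.toReal⁻¹

open ProbabilityTheory in
/-- The cumulative distribution function of an atomless measure is continuous. -/
lemma continuous_cdf_of_nullSingleton (μ : Measure ℝ) [IsProbabilityMeasure μ] [NullSingletonClass μ] :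
    Continuous (cdf μ) := by
  rw [continuous_iff_continuousAt]
  intro x
  have h0 : (cdf μ).measure {x} = 0 := by rw [measure_cdf]; exact measure_singleton x
  rw [StieltjesFunction.measure_singleton, ENNReal.ofReal_eq_zero, sub_nonpos] at h0
  refine continuousAt_iff_continuous_left'_right'.2 ⟨?_, ?_⟩
  · exact (Monotone.continuousWithinAt_Iio_iff_leftLim_eq (cdf μ).mono).2
      (le_antisymm ((cdf μ).mono.leftLim_le le_rfl) h0)
  · exact ((cdf μ).right_continuous x).mono Ioi_subset_Ici_self

open ProbabilityTheory in
/-- Probability integral transform: the cumulative distribution function of an atomless measure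
pushes it forward to the uniform measure on the unit interval. -/
lemma exists_measurable_map_eq_volume_unitInterval (μ : Measure ℝ) [IsProbabilityMeasure μ]
    [NullSingletonClass μ] : ∃ F : ℝ → unitInterval, Measurable F ∧ μ.map F = volume := by
  have hc := continuous_cdf_of_nullSingleton μ
  have hF : Measurable fun x => (⟨cdf μ x, cdf_nonneg μ x, cdf_le_one μ x⟩ : unitInterval) :=
    (hc.subtype_mk _).measurable
  refine ⟨_, hF, ?_⟩
  have : IsProbabilityMeasure (μ.map fun x =>
      (⟨cdf μ x, cdf_nonneg μ x, cdf_le_one μ x⟩ : unitInterval)) :=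
    Measure.isProbabilityMeasure_map hF.aemeasurable
  refine Measure.ext_of_Iic _ _ fun y => ?_
  rw [Measure.map_apply hF measurableSet_Iic, unitInterval.volume_Iic]
  change μ {x | cdf μ x ≤ y} = _
  have attained : ∀ z : ℝ, 0 < z → z < 1 → ∃ x, cdf μ x = z := fun z h0 h1 =>
    mem_range_of_exists_le_of_exists_ge hc
      ((tendsto_cdf_atBot μ).eventually (eventually_le_nhds h0)).exists
      ((tendsto_cdf_atTop μ).eventually (eventually_ge_nhds h1)).exists
  rcases eq_or_lt_of_le y.2.2 with h1 | h1
  · have : {x | cdf μ x ≤ (y : ℝ)} = univ := by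
      ext x; simpa [h1] using cdf_le_one μ x
    rw [this, h1]
    simp
  refine le_antisymm ?_ ?_
  · refine le_of_forall_gt_imp_ge_of_dense fun c hyc => ?_
    obtain ⟨z, hz, hzc⟩ : ∃ z : ℝ, ((y : ℝ) < z ∧ z < 1) ∧ ENNReal.ofReal z ≤ c := by
      rcases le_total 1 c with hc1 | hc1
      · obtain ⟨z, hz⟩ := exists_between h1
        exact ⟨z, hz, le_trans (by simpa using hz.2.le) hc1⟩
      · have hct : c ≠ ⊤ := ne_top_of_le_ne_top ENNReal.one_ne_top hc1
        have hyc' : (y : ℝ) < c.toReal := (ENNReal.ofReal_lt_iff_lt_toReal y.2.1 hct).1 hyc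
        obtain ⟨z, hz⟩ := exists_between hyc'
        refine ⟨z, ⟨hz.1, hz.2.trans_le ?_⟩, ENNReal.ofReal_le_of_le_toReal hz.2.le⟩
        simpa using ENNReal.toReal_mono ENNReal.one_ne_top hc1
    obtain ⟨x, hx⟩ := attained z (y.2.1.trans_lt hz.1) hz.2
    calc μ {x | cdf μ x ≤ y} ≤ μ (Iic x) := measure_mono fun w hw => by
          by_contra hwx
          have := monotone_cdf μ (not_le.1 hwx).le
          simp only [mem_ofPred_eq] at hw
          linarith
      _ = ENNReal.ofReal z := by rw [← ofReal_cdf, hx]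
      _ ≤ c := hzc
  · rcases eq_or_lt_of_le y.2.1 with h0 | h0
    · simp [← h0]
    obtain ⟨x, hx⟩ := attained y h0 h1
    calc ENNReal.ofReal y = μ (Iic x) := by rw [← hx, ofReal_cdf]
      _ ≤ μ {x | cdf μ x ≤ y} := measure_mono fun w hw => by
          simpa only [mem_ofPred_eq, ← hx] using monotone_cdf μ hw

/-- An atomless probability measure on the line can be transported onto any other one. -/
lemma exists_measurable_map_eq_of_isProbabilityMeasure (μ ν : Measure ℝ) [IsProbabilityMeasure μ]
    [NullSingletonClass μ] [IsProbabilityMeasure ν] : ∃ T : ℝ → ℝ, Measurable T ∧ μ.map T = ν := by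
  obtain ⟨F, hF, hFμ⟩ := exists_measurable_map_eq_volume_unitInterval μ
  obtain ⟨G, hG, hGν⟩ := ν.exists_measurable_map_eq
  exact ⟨G ∘ F, hG.comp hF, by rw [← Measure.map_map hG hF, hFμ, hGν]⟩

/-- An atomless finite measure on the line can be transported onto any other one of the same
total mass. -/
lemma exists_measurable_map_eq_of_measure_univ_eq (μ ν : Measure ℝ) [IsFiniteMeasure μ]
    [NullSingletonClass μ] (h : μ univ = ν univ) : ∃ T : ℝ → ℝ, Measurable T ∧ μ.map T = ν := by
  rcases eq_or_ne (μ univ) 0 with h0 | h0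
  · have h0' : ν univ = 0 := h ▸ h0
    refine ⟨id, measurable_id, ?_⟩
    rw [Measure.measure_univ_eq_zero.1 h0, Measure.measure_univ_eq_zero.1 h0']
    simp
  have ht : μ univ ≠ ⊤ := measure_ne_top μ univ
  have : NeZero μ := ⟨fun hμ => h0 (by simp [hμ])⟩
  have : IsProbabilityMeasure ((μ univ)⁻¹ • ν) :=
    ⟨by simp [← h, ENNReal.inv_mul_cancel h0 ht]⟩
  have : NullSingletonClass ((μ univ)⁻¹ • μ) := ⟨fun x => by simp⟩
  obtain ⟨T, hT, hTν⟩ :=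
    exists_measurable_map_eq_of_isProbabilityMeasure ((μ univ)⁻¹ • μ) ((μ univ)⁻¹ • ν)
  refine ⟨T, hT, ?_⟩
  rw [Measure.map_smul] at hTν
  have := congrArg (fun m => μ univ • m) hTν
  simpa [smul_smul, ENNReal.mul_inv_cancel h0 ht] using this

/-- Transport respecting labels: if the countably valued labels `a` and `b` have the same law
under `μ` and `ν`, then an atomless `μ` can be transported onto `ν` by a map that matches the
labels almost everywhere. -/
lemma exists_measurable_map_eq_label_eq {ι : Type*} [Countable ι] [MeasurableSpace ι]
    [MeasurableSingletonClass ι] (μ ν : Measure ℝ) [IsFiniteMeasure μ] [NullSingletonClass μ]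
    {a b : ℝ → ι} (ha : Measurable a) (hb : Measurable b) (h : μ.map a = ν.map b) :
    ∃ T : ℝ → ℝ, Measurable T ∧ μ.map T = ν ∧ ∀ᵐ x ∂μ, b (T x) = a x := by
  have hpa (i : ι) : MeasurableSet (a ⁻¹' {i}) := ha (measurableSet_singleton i)
  have hpb (i : ι) : MeasurableSet (b ⁻¹' {i}) := hb (measurableSet_singleton i)
  have key (i : ι) : ∃ T : ℝ → ℝ, Measurable T ∧
      (μ.restrict (a ⁻¹' {i})).map T = ν.restrict (b ⁻¹' {i}) := by
    refine exists_measurable_map_eq_of_measure_univ_eq _ _ ?_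
    rw [Measure.restrict_apply_univ, Measure.restrict_apply_univ,
      ← Measure.map_apply ha (measurableSet_singleton i), h,
      Measure.map_apply hb (measurableSet_singleton i)]
  choose T hT hTν using key
  have hm : Measurable fun x => T (a x) x :=
    (measurable_from_prod_countable_right (f := fun p : ι × ℝ => T p.1 p.2) hT).comp
      (ha.prodMk measurable_id)
  have fiber (i : ι) {S : Set ℝ} (hS : MeasurableSet S) :
      μ ((fun x => T (a x) x) ⁻¹' S ∩ a ⁻¹' {i}) = ν (S ∩ b ⁻¹' {i}) := by
    rw [← Measure.restrict_apply hS, ← hTν i, Measure.map_apply (hT i) hS,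
      Measure.restrict_apply (hT i hS)]
    congr 1
    ext x
    simp only [mem_inter_iff, mem_preimage, mem_singleton_iff]
    constructor <;> rintro ⟨h1, rfl⟩ <;> exact ⟨h1, rfl⟩
  refine ⟨_, hm, ?_, ?_⟩
  · ext S hS
    have hμ := tsum_measure_preimage_singleton (μ := μ.restrict ((fun x => T (a x) x) ⁻¹' S))
      (countable_univ (α := ι)) (f := a) fun i _ => hpa i
    have hν := tsum_measure_preimage_singleton (μ := ν.restrict S)
      (countable_univ (α := ι)) (f := b) fun i _ => hpb i
    rw [preimage_univ, Measure.restrict_apply_univ] at hμ hν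
    rw [Measure.map_apply hm hS, ← hμ, ← hν]
    refine tsum_congr fun i => ?_
    rw [Measure.restrict_apply (hpa i), Measure.restrict_apply (hpb i), inter_comm,
      fiber i hS, inter_comm]
  · have hae (i : ι) : ∀ᵐ x ∂μ, ¬ (b (T (a x) x) ≠ i ∧ a x = i) := by
      rw [ae_iff]
      have := fiber i (hpb i).compl
      rw [compl_inter_self, measure_empty] at this
      simp only [not_not]
      exact this
    filter_upwards [ae_all_iff.2 hae] with x hx
    by_contra hne
    exact hx (a x) ⟨hne, rfl⟩

lemma equiMeas_iff_restrict (u v : ℝ → ℝ) :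
    EquiMeas u v ↔ ∀ lam : ℝ, 0 < lam →
      volume.restrict (Ioo (0 : ℝ) 1) {t | lam < u t} =
        volume.restrict (Ioo (0 : ℝ) 1) {t | lam < v t} := by
  refine forall₂_congr fun lam _ => ?_
  rw [Measure.restrict_apply' measurableSet_Ioo, Measure.restrict_apply' measurableSet_Ioo,
    inter_comm, inter_comm {t | lam < v t}]
  rfl

lemma EquiMeas.congr_ae {u v u' v' : ℝ → ℝ} (h : EquiMeas u v)
    (hu : u =ᵐ[volume.restrict (Ioo (0 : ℝ) 1)] u')
    (hv : v =ᵐ[volume.restrict (Ioo (0 : ℝ) 1)] v') : EquiMeas u' v' := by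
  rw [equiMeas_iff_restrict] at h ⊢
  intro lam hlam
  have level {w w' : ℝ → ℝ} (hw : w =ᵐ[volume.restrict (Ioo (0 : ℝ) 1)] w') :
      volume.restrict (Ioo (0 : ℝ) 1) {t | lam < w t} =
        volume.restrict (Ioo (0 : ℝ) 1) {t | lam < w' t} :=
    measure_congr <| eventuallyEq_set.2 <| hw.mono fun t ht => by
      simp only [mem_ofPred_eq, ht]
  rw [← level hu, ← level hv, h lam hlam]

lemma isProbabilityMeasure_restrict_Ioo_zero_one :
    IsProbabilityMeasure (volume.restrict (Ioo (0 : ℝ) 1)) :=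
  ⟨by simp⟩

lemma EquiMeas.map_eq {u v : ℝ → ℝ} (h : EquiMeas u v) (hu : Measurable u) (hv : Measurable v)
    (hu0 : 0 ≤ u) (hv0 : 0 ≤ v) :
    (volume.restrict (Ioo (0 : ℝ) 1)).map u = (volume.restrict (Ioo (0 : ℝ) 1)).map v := by
  have := isProbabilityMeasure_restrict_Ioo_zero_one
  rw [equiMeas_iff_restrict] at h
  set P := volume.restrict (Ioo (0 : ℝ) 1)
  have hPu : IsProbabilityMeasure (P.map u) := Measure.isProbabilityMeasure_map hu.aemeasurable
  have hPv : IsProbabilityMeasure (P.map v) := Measure.isProbabilityMeasure_map hv.aemeasurable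
  have hpos (a : ℝ) (ha : 0 < a) : P.map u (Ioi a) = P.map v (Ioi a) := by
    rw [Measure.map_apply hu measurableSet_Ioi, Measure.map_apply hv measurableSet_Ioi]
    exact h a ha
  have hneg {w : ℝ → ℝ} (hw : Measurable w) (hw0 : 0 ≤ w) (a : ℝ) (ha : a < 0) :
      P.map w (Ioi a) = P univ := by
    rw [Measure.map_apply hw measurableSet_Ioi]
    congr 1
    exact eq_univ_of_forall fun x => ha.trans_le (hw0 x)
  have hzero : P.map u (Ioi 0) = P.map v (Ioi 0) := by
    have hU : Ioi (0 : ℝ) = ⋃ n : ℕ, Ioi (1 / ((n : ℝ) + 1)) := by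
      ext x
      simp only [mem_Ioi, mem_iUnion]
      exact ⟨fun hx => exists_nat_one_div_lt hx,
        fun ⟨n, hn⟩ => lt_trans Nat.one_div_pos_of_nat hn⟩
    have hmono : Monotone fun n : ℕ => Ioi (1 / ((n : ℝ) + 1)) :=
      fun m n hmn => Ioi_subset_Ioi (Nat.one_div_le_one_div hmn)
    rw [hU, hmono.measure_iUnion, hmono.measure_iUnion]
    exact iSup_congr fun n => hpos _ Nat.one_div_pos_of_nat
  refine Measure.ext_of_Iic _ _ fun a => ?_
  rw [← compl_Ioi, prob_compl_eq_one_sub measurableSet_Ioi,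
    prob_compl_eq_one_sub measurableSet_Ioi]
  congr 1
  rcases lt_trichotomy a 0 with ha | rfl | ha
  · rw [hneg hu hu0 a ha, hneg hv hv0 a ha]
  · exact hzero
  · exact hpos a ha

/-- Given nonnegative identically distributed `u` and `v`, one can rearrange `v` so as to
dominate `u` up to a factor `exp L` arbitrarily close to one. -/
lemma exists_measurePreserving_le_exp_mul {μ : Measure ℝ} [IsFiniteMeasure μ]
    [NullSingletonClass μ] {u v : ℝ → ℝ} (hu : Measurable u) (hv : Measurable v)
    (hu0 : 0 ≤ u) (hv0 : 0 ≤ v) (h : μ.map u = μ.map v) {L : ℝ} (hL : 0 < L) :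
    ∃ T : ℝ → ℝ, MeasurePreserving T μ μ ∧ ∀ᵐ x ∂μ, u x ≤ Real.exp L * v (T x) := by
  let c : ℝ → ℤ × ℤ := fun x => (⌊Real.log x / L⌋, if 0 < x then 1 else 0)
  have hc : Measurable c := by
    refine ((Real.measurable_log.div_const L).floor).prodMk ?_
    exact Measurable.ite measurableSet_Ioi measurable_const measurable_const
  have hlabel : μ.map (c ∘ u) = μ.map (c ∘ v) := by
    rw [← Measure.map_map hc hu, h, Measure.map_map hc hv]
  obtain ⟨T, hT, hTμ, hTc⟩ :=
    exists_measurable_map_eq_label_eq μ μ (hc.comp hu) (hc.comp hv) hlabel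
  refine ⟨T, ⟨hT, hTμ⟩, hTc.mono fun x hx => ?_⟩
  obtain ⟨h1, h2⟩ := Prod.ext_iff.1 hx
  simp only [Function.comp_apply, c] at h1 h2
  rcases (hu0 x).eq_or_lt with hx0 | hx0
  · rw [← hx0]
    exact mul_nonneg (Real.exp_pos L).le (hv0 _)
  have hx0' : 0 < u x := hx0
  have hy0 : 0 < v (T x) := by
    by_contra hy
    simp [hx0', hy] at h2
  have hlt := (abs_lt.1 (Int.abs_sub_lt_one_of_floor_eq_floor h1)).1
  rw [← sub_div, lt_div_iff₀ hL] at hlt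
  calc u x = Real.exp (Real.log (u x)) := (Real.exp_log hx0').symm
    _ ≤ Real.exp (L + Real.log (v (T x))) := Real.exp_le_exp.2 (by linarith)
    _ = Real.exp L * v (T x) := by rw [Real.exp_add, Real.exp_log hy0]

lemma lqNormE_eq_eLpNorm {q : ℝ≥0∞} (hq : q ≠ 0) (F : ℝ → ℝ≥0∞) :
    lqNormE q F = eLpNorm F q (volume.restrict (Ioo (0 : ℝ) 1)) := by
  unfold lqNormE
  split_ifs with h
  · simp [h, eLpNorm_exponent_top, eLpNormEssSup_eq_essSup_enorm]
  · simp [eLpNorm_eq_lintegral_rpow_enorm_toReal hq h]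

lemma lqNormE_le_mul_add {q : ℝ≥0∞} (hq : 1 ≤ q) {F G K : ℝ → ℝ≥0∞} (hG : Measurable G)
    (hK : Measurable K) {c : NNReal} (h : ∀ t ∈ Ioo (0 : ℝ) 1, F t ≤ c * (G t + K t)) :
    lqNormE q F ≤ c * (lqNormE q G + lqNormE q K) := by
  have hq0 : q ≠ 0 := (zero_lt_one.trans_le hq).ne'
  simp only [lqNormE_eq_eLpNorm hq0]
  refine (eLpNorm_le_nnreal_smul_eLpNorm_of_ae_le_mul' (g := G + K) (c := c) ?_ q).trans ?_
  · exact ae_restrict_of_forall_mem measurableSet_Ioo fun t ht => by simpa using h t ht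
  · rw [ENNReal.smul_def, smul_eq_mul]
    gcongr
    exact eLpNorm_add_le hG.aestronglyMeasurable hK.aestronglyMeasurable hq

lemma antitone_opHE (J : ℝ → ℝ) (j : ℕ) (f : ℝ → ℝ) : Antitone (opHE J j f) := by
  intro a b hab
  unfold opHE
  gcongr

lemma opHE_le_mul_add {J : ℝ → ℝ} (hJ : AEMeasurable J (volume.restrict (Ioo (0 : ℝ) 1))) (j : ℕ)
    {f u v : ℝ → ℝ} (hu : Measurable u) {c : ℝ} (hc : 0 ≤ c)
    (h : ∀ᵐ s ∂volume.restrict (Ioo (0 : ℝ) 1), |f s| ≤ c * (|u s| + |v s|))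
    {t : ℝ} (ht : 0 ≤ t) :
    opHE J j f t ≤ ENNReal.ofReal c * (opHE J j u t + opHE J j v t) := by
  have hsub : Ioo t 1 ⊆ Ioo (0 : ℝ) 1 := Ioo_subset_Ioo_left ht
  have hker : Measurable fun s => ∫⁻ r in Ioo t s, (ENNReal.ofReal (J r))⁻¹ :=
    Monotone.measurable fun a b hab => lintegral_mono_set (Ioo_subset_Ioo_right hab)
  have hmeas : AEMeasurable (fun s => ENNReal.ofReal |u s| / ENNReal.ofReal (J s) *
      (∫⁻ r in Ioo t s, (ENNReal.ofReal (J r))⁻¹) ^ (j - 1)) (volume.restrict (Ioo t 1)) :=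
    (((measurable_norm.comp hu).ennreal_ofReal.aemeasurable).div
      (hJ.mono_measure (Measure.restrict_mono_set _ hsub)).ennreal_ofReal).mul
      (hker.pow_const _).aemeasurable
  unfold opHE
  rw [← mul_add, ← lintegral_add_left' hmeas, mul_left_comm,
    ← lintegral_const_mul' _ _ ENNReal.ofReal_ne_top]
  refine mul_le_mul_right (lintegral_mono_ae ((ae_restrict_of_ae_restrict_of_subset hsub h).mono fun s hs => ?_)) _
  simp only [← add_mul, ← ENNReal.add_div, ← mul_assoc, ← mul_div_assoc,
    ← ENNReal.ofReal_add (abs_nonneg _) (abs_nonneg _), ← ENNReal.ofReal_mul hc]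
  gcongr

/-- If `h` is a rearrangement of `f + g`, the norm of its image under `H^j_J` is controlled, up to
a factor arbitrarily close to one, by those of rearrangements of `f` and of `g`. -/
lemma exists_equiMeas_lqNormE_le {J : ℝ → ℝ}
    (hJ : AEMeasurable J (volume.restrict (Ioo (0 : ℝ) 1))) (j : ℕ) {q : ℝ≥0∞} (hq : 1 ≤ q)
    {f g h : ℝ → ℝ} (hfm : AEMeasurable f (volume.restrict (Ioo (0 : ℝ) 1)))
    (hf0 : ∀ t ∈ Ioo (0 : ℝ) 1, 0 ≤ f t)
    (hgm : AEMeasurable g (volume.restrict (Ioo (0 : ℝ) 1)))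
    (hg0 : ∀ t ∈ Ioo (0 : ℝ) 1, 0 ≤ g t)
    (hhm : AEMeasurable h (volume.restrict (Ioo (0 : ℝ) 1)))
    (hh0 : ∀ t ∈ Ioo (0 : ℝ) 1, 0 ≤ h t)
    (hfgh : EquiMeas h (fun t => f t + g t)) {L : ℝ} (hL : 0 < L) :
    ∃ u v : ℝ → ℝ, (Measurable u ∧ 0 ≤ u ∧ EquiMeas u f) ∧ (Measurable v ∧ 0 ≤ v ∧ EquiMeas v g) ∧
      lqNormE q (opHE J j h) ≤
        ENNReal.ofReal (Real.exp L) * (lqNormE q (opHE J j u) + lqNormE q (opHE J j v)) := by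
  have := isProbabilityMeasure_restrict_Ioo_zero_one
  obtain ⟨f', hf'm, hf'0, hff'⟩ :=
    hfm.exists_measurable_nonneg (ae_restrict_of_forall_mem measurableSet_Ioo hf0)
  obtain ⟨g', hg'm, hg'0, hgg'⟩ :=
    hgm.exists_measurable_nonneg (ae_restrict_of_forall_mem measurableSet_Ioo hg0)
  obtain ⟨h', hh'm, hh'0, hhh'⟩ :=
    hhm.exists_measurable_nonneg (ae_restrict_of_forall_mem measurableSet_Ioo hh0)
  have hmap := (hfgh.congr_ae hhh' (hff'.add hgg')).map_eq hh'm (hf'm.add hg'm) hh'0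
    (add_nonneg hf'0 hg'0)
  obtain ⟨T, hT, hle⟩ := exists_measurePreserving_le_exp_mul hh'm (hf'm.add hg'm) hh'0
    (add_nonneg hf'0 hg'0) hmap hL
  have equi {w w' : ℝ → ℝ} (hw' : Measurable w')
      (hw : w =ᵐ[volume.restrict (Ioo (0 : ℝ) 1)] w') : EquiMeas (w' ∘ T) w := by
    refine EquiMeas.congr_ae ?_ EventuallyEq.rfl hw.symm
    rw [equiMeas_iff_restrict]
    exact fun lam _ =>
      hT.measure_preimage (measurableSet_lt measurable_const hw').nullMeasurableSet
  have hum : Measurable (f' ∘ T) := hf'm.comp hT.measurable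
  have hvm : Measurable (g' ∘ T) := hg'm.comp hT.measurable
  refine ⟨f' ∘ T, g' ∘ T, ⟨hum, fun x => hf'0 (T x), equi hf'm hff'⟩,
    ⟨hvm, fun x => hg'0 (T x), equi hg'm hgg'⟩, ?_⟩
  refine lqNormE_le_mul_add hq (antitone_opHE J j _).measurable (antitone_opHE J j _).measurable
    fun t ht => opHE_le_mul_add hJ j hum (Real.exp_pos L).le ?_ ht.1.le
  filter_upwards [hle, hhh'] with s hs heq
  have h1 : 0 ≤ f' (T s) := hf'0 _
  have h2 : 0 ≤ g' (T s) := hg'0 _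
  have h3 : 0 ≤ h' s := hh'0 s
  rw [heq, abs_of_nonneg h3, Function.comp_apply, Function.comp_apply, abs_of_nonneg h1,
    abs_of_nonneg h2]
  exact hs

/-- Subadditivity of the functional `f ↦ sup { ‖H^j_J h‖_{L^q} : h ≥ 0, h ∼ f }`:
for nonnegative measurable `f, g`,
`sup_{h ∼ f+g} ‖H^j_J h‖_{L^q} ≤ sup_{h ∼ f} ‖H^j_J h‖_{L^q} + sup_{h ∼ g} ‖H^j_J h‖_{L^q}`. -/
theorem sup_over_equimeasurable_subadditive
    (J : ℝ → ℝ)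
    (hJmeas : AEMeasurable J (MeasureTheory.volume.restrict (Set.Ioc (0:ℝ) 1)))
    (hJpos : ∀ t ∈ Set.Ioc (0:ℝ) 1, 0 < J t)
    (hJinf : ∃ c : ℝ, 0 < c ∧ ∀ t ∈ Set.Ioc (0:ℝ) 1, c * t ≤ J t)
    (j : ℕ) (hj : 1 ≤ j)
    (q : ℝ≥0∞) (hq : 1 ≤ q)
    (f g : ℝ → ℝ)
    (hfmeas : AEMeasurable f (MeasureTheory.volume.restrict (Set.Ioo (0:ℝ) 1)))
    (hf0 : ∀ t ∈ Set.Ioo (0:ℝ) 1, 0 ≤ f t)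
    (hgmeas : AEMeasurable g (MeasureTheory.volume.restrict (Set.Ioo (0:ℝ) 1)))
    (hg0 : ∀ t ∈ Set.Ioo (0:ℝ) 1, 0 ≤ g t) :
    (⨆ h ∈ {h : ℝ → ℝ | (∀ t ∈ Set.Ioo (0:ℝ) 1, 0 ≤ h t) ∧
        AEMeasurable h (MeasureTheory.volume.restrict (Set.Ioo (0:ℝ) 1)) ∧
        EquiMeas h (fun t => f t + g t)},
      lqNormE q (opHE J j h)) ≤
    (⨆ h ∈ {h : ℝ → ℝ | (∀ t ∈ Set.Ioo (0:ℝ) 1, 0 ≤ h t) ∧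
        AEMeasurable h (MeasureTheory.volume.restrict (Set.Ioo (0:ℝ) 1)) ∧ EquiMeas h f},
      lqNormE q (opHE J j h)) +
    ⨆ h ∈ {h : ℝ → ℝ | (∀ t ∈ Set.Ioo (0:ℝ) 1, 0 ≤ h t) ∧
        AEMeasurable h (MeasureTheory.volume.restrict (Set.Ioo (0:ℝ) 1)) ∧ EquiMeas h g},
      lqNormE q (opHE J j h) := by
  have hJ : AEMeasurable J (volume.restrict (Ioo (0 : ℝ) 1)) :=
    hJmeas.mono_measure (Measure.restrict_mono_set _ Ioo_subset_Ioc_self)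
  refine iSup₂_le fun h hh => ?_
  obtain ⟨hh0, hhm, hfgh⟩ := hh
  have hlim (C : ℝ≥0∞) : Tendsto (fun L : ℝ => ENNReal.ofReal (Real.exp L) * C)
      (nhdsWithin 0 (Ioi 0)) (nhds C) := by
    have hexp : Tendsto (fun L : ℝ => ENNReal.ofReal (Real.exp L)) (nhdsWithin 0 (Ioi 0))
        (nhds 1) := by
      have := (ENNReal.continuous_ofReal.comp Real.continuous_exp).tendsto 0
      simp only [Function.comp_apply, Real.exp_zero, ENNReal.ofReal_one] at this
      exact this.mono_left nhdsWithin_le_nhds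
    simpa using ENNReal.Tendsto.mul_const (b := C) hexp (Or.inl one_ne_zero)
  refine ge_of_tendsto (hlim _) (eventually_nhdsWithin_of_forall fun L hL => ?_)
  obtain ⟨u, v, ⟨hum, hu0, huf⟩, ⟨hvm, hv0, hvg⟩, hle⟩ :=
    exists_equiMeas_lqNormE_le hJ j hq hfmeas hf0 hgmeas hg0 hhm hh0 hfgh hL
  refine hle.trans ?_
  gcongr
  · exact le_iSup₂_of_le u ⟨fun t _ => hu0 t, hum.aemeasurable, huf⟩ le_rfl
  · exact le_iSup₂_of_le v ⟨fun t _ => hv0 t, hvm.aemeasurable, hvg⟩ le_rfl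
end

section
/- Let u and v be nonnegative simple measurable functions on (0,1), and let h be a nonnegative measurable function on (0,1) which is equimeasurable with u + v. Then there exist nonnegative simple measurable functions h_u and h_v on (0,1) such that h = h_u + h_v almost everywhere, h_u is equimeasurable with u, and h_v is equimeasurable with v. -/
open MeasureTheory Set Filter
open scoped ENNReal

/-- A simple function on (0,1): Lebesgue measurable and taking only finitely many values
on (0,1). -/
def IsSimpleOn (u : ℝ → ℝ) : Prop :=
  AEMeasurable u (MeasureTheory.volume.restrict (Set.Ioo (0:ℝ) 1)) ∧
    (u '' Set.Ioo (0:ℝ) 1).Finite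

/-- A finite atomless measure on the line takes every intermediate value on subsets of a given
measurable set. -/
theorem exists_measurableSet_subset_measure_eq {μ : Measure ℝ} [IsFiniteMeasure μ] [NullSingletonClass μ]
    {A : Set ℝ} (hA : MeasurableSet A) {r : ℝ≥0∞} (hr : r ≤ μ A) :
    ∃ B ⊆ A, MeasurableSet B ∧ μ B = r := by
  rcases eq_or_ne r 0 with rfl | h0
  · exact ⟨∅, empty_subset _, .empty, measure_empty⟩
  rcases hr.eq_or_lt with rfl | hlt
  · exact ⟨A, Subset.rfl, hA, rfl⟩
  have hrtop : r ≠ ∞ := hlt.ne_top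
  obtain ⟨ν, hν⟩ : ∃ ν, ν = μ.restrict A := ⟨_, rfl⟩
  have : IsFiniteMeasure ν := hν ▸ inferInstance
  have : NullSingletonClass ν := hν ▸ inferInstance
  have hcont : Continuous fun x => ν.real (Iic x) := by
    have h1 : ∀ x, ν.real (Iic x) = ν.real (Iic 0) + ∫ _ in (0 : ℝ)..x, (1 : ℝ) ∂ν := fun x => by
      rw [← intervalIntegral.integral_Iic_sub_Iic (integrable_const _).integrableOn
        (integrable_const _).integrableOn]
      simp only [setIntegral_const, smul_eq_mul, mul_one]
      ring
    rw [funext h1]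
    exact continuous_const.add
      (intervalIntegral.continuous_primitive (fun a b => by simp) 0)
  have htop : Tendsto (fun x => ν (Iic x)) atTop (nhds (ν univ)) := tendsto_measure_Iic_atTop ν
  have hbot : Tendsto (fun x => ν (Iic x)) atBot (nhds 0) := by
    have := tendsto_measure_iInter_atBot (μ := ν) (s := Iic)
      (fun _ => measurableSet_Iic.nullMeasurableSet) monotone_Iic ⟨0, measure_ne_top _ _⟩
    rwa [iInter_Iic_eq_empty_iff.2 (by simp [not_bddBelow_univ]), measure_empty] at this
  have hx : r.toReal ∈ range fun x => ν.real (Iic x) := by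
    refine mem_range_of_exists_le_of_exists_ge hcont ?_ ?_
    · obtain ⟨a, ha⟩ := (hbot.eventually (gt_mem_nhds (pos_iff_ne_zero.2 h0))).exists
      exact ⟨a, ENNReal.toReal_mono hrtop ha.le⟩
    · obtain ⟨a, ha⟩ := (htop.eventually (lt_mem_nhds (by simpa [hν] using hlt))).exists
      exact ⟨a, ENNReal.toReal_mono (measure_ne_top _ _) ha.le⟩
  obtain ⟨x, hx⟩ := hx
  refine ⟨Iic x ∩ A, inter_subset_right, measurableSet_Iic.inter hA, ?_⟩
  rw [← Measure.restrict_apply measurableSet_Iic, ← hν]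
  exact (ENNReal.toReal_eq_toReal_iff' (measure_ne_top _ _) hrtop).1 hx

theorem exists_pairwiseDisjoint_subset_measure_eq {ι : Type*} {μ : Measure ℝ} [IsFiniteMeasure μ]
    [NullSingletonClass μ] {A : Set ℝ} (hA : MeasurableSet A) (s : Finset ι) (r : ι → ℝ≥0∞)
    (hr : ∑ i ∈ s, r i ≤ μ A) :
    ∃ E : ι → Set ℝ, (∀ i, E i ⊆ A) ∧ (∀ i, MeasurableSet (E i)) ∧
      (s : Set ι).PairwiseDisjoint E ∧ ∀ i ∈ s, μ (E i) = r i := by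
  classical
  induction s using Finset.induction_on generalizing A with
  | empty => exact ⟨fun _ => ∅, by simp⟩
  | insert a s ha ih =>
    rw [Finset.sum_insert ha] at hr
    obtain ⟨B, hBA, hB, hBr⟩ :=
      exists_measurableSet_subset_measure_eq hA (le_self_add.trans hr)
    obtain ⟨E, hEA, hE, hd, hEr⟩ := ih (hA.diff hB) (by
      rw [measure_sdiff hBA hB.nullMeasurableSet (measure_ne_top _ _), hBr]
      exact ENNReal.le_sub_of_add_le_left (hBr ▸ measure_ne_top _ _) hr)
    have hne : ∀ i ∈ s, i ≠ a := fun i hi h => ha (h ▸ hi)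
    refine ⟨Function.update E a B, fun i => ?_, fun i => ?_, ?_, fun i hi => ?_⟩
    · rcases eq_or_ne i a with rfl | h
      · simpa using hBA
      · simpa [h] using (hEA i).trans sdiff_subset
    · rcases eq_or_ne i a with rfl | h
      · simpa using hB
      · simpa [h] using hE i
    · rw [Finset.coe_insert, pairwiseDisjoint_insert]
      refine ⟨fun i hi j hj hij => ?_, fun j hj _ => ?_⟩
      · simpa [Function.onFun, hne i hi, hne j hj] using hd hi hj hij
      · simpa [hne j hj] using disjoint_sdiff_right.mono_right (hEA j)
    · rcases Finset.mem_insert.1 hi with rfl | h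
      · simpa using hBr
      · simpa [hne i h] using hEr i h

theorem exists_pairwiseDisjoint_subset_fiber_measure_eq {ι β : Type*} [MeasurableSpace β]
    [MeasurableSingletonClass β] [DecidableEq β] {μ : Measure ℝ} [IsFiniteMeasure μ]
    [NullSingletonClass μ]
    {h : ℝ → β} (hh : Measurable h) (s : Finset ι) (c : ι → β) (r : ι → ℝ≥0∞)
    (hr : ∀ x, ∑ i ∈ s with c i = x, r i ≤ μ (h ⁻¹' {x})) :
    ∃ E : ι → Set ℝ, (∀ i, E i ⊆ h ⁻¹' {c i}) ∧ (∀ i, MeasurableSet (E i)) ∧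
      (s : Set ι).PairwiseDisjoint E ∧ ∀ i ∈ s, μ (E i) = r i := by
  choose E hsub hE hd hEr using fun x => exists_pairwiseDisjoint_subset_measure_eq
    (hh (measurableSet_singleton x)) _ r (hr x)
  refine ⟨fun i => E (c i) i, fun i => hsub _ i, fun i => hE _ i, fun i hi j hj hij => ?_,
    fun i hi => hEr _ i (by simp [hi])⟩
  by_cases hc : c i = c j
  · have := hd (c i) (by simpa using hi) (by simpa [hc] using hj) hij
    simpa [Function.onFun, hc] using this
  · refine Disjoint.mono (hsub _ i) (hsub _ j) ?_
    exact Disjoint.preimage h (by simpa using hc)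

/-- A finitely supported joint law whose image under `φ` is the law of `h` is realised by a
finitely valued measurable function `g` with `φ ∘ g = h` almost everywhere. -/
theorem exists_measurable_mem_finset_map_eq {α β : Type*} [MeasurableSpace α]
    [MeasurableSingletonClass α] [MeasurableSpace β] [MeasurableSingletonClass β] {μ : Measure ℝ}
    [IsProbabilityMeasure μ] [NullSingletonClass μ] {ρ : Measure α} [IsProbabilityMeasure ρ]
    {φ : α → β} (hφ : Measurable φ) {h : ℝ → β} (hh : AEMeasurable h μ)
    (hlaw : μ.map h = ρ.map φ) (s : Finset α) (hs : ρ s = 1) :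
    ∃ g : ℝ → α, Measurable g ∧ (∀ t, g t ∈ s) ∧
      (∀ᵐ t ∂μ, h t = φ (g t)) ∧ μ.map g = ρ := by
  classical
  have hr : ∀ x, ∑ p ∈ s with φ p = x, ρ {p} ≤ μ (hh.mk h ⁻¹' {x}) := fun x => by
    rw [sum_measure_singleton, ← Measure.map_apply hh.measurable_mk (measurableSet_singleton x),
      ← Measure.map_congr hh.ae_eq_mk, hlaw, Measure.map_apply hφ (measurableSet_singleton x)]
    exact measure_mono fun p hp => (Finset.mem_filter.1 hp).2
  obtain ⟨E, hsub, hE, hd, hEr⟩ :=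
    exists_pairwiseDisjoint_subset_fiber_measure_eq hh.measurable_mk s φ _ hr
  obtain ⟨p₀, hp₀⟩ : s.Nonempty := by
    rw [Finset.nonempty_iff_ne_empty]
    rintro rfl
    simp at hs
  have hg : ∀ t, ∃ p ∈ s, (∀ q ∈ s, t ∈ E q → q = p) ∧ ((∀ q ∈ s, t ∉ E q) → p = p₀) := fun t => by
    by_cases ht : ∃ p ∈ s, t ∈ E p
    · obtain ⟨p, hp, htp⟩ := ht
      refine ⟨p, hp, fun q hq htq => ?_, fun hn => absurd htp (hn p hp)⟩
      by_contra hqp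
      exact disjoint_left.1 (hd hq hp hqp) htq htp
    · push Not at ht
      exact ⟨p₀, hp₀, fun q hq htq => absurd htq (ht q hq), fun _ => rfl⟩
  choose g hgs hgE hg0 using hg
  have hfib : ∀ p ∈ s, g ⁻¹' {p} = E p ∪ if p = p₀ then (⋃ q ∈ s, E q)ᶜ else ∅ := fun p hp => by
    ext t
    by_cases ht : ∃ q ∈ s, t ∈ E q
    · obtain ⟨q, hq, htq⟩ := ht
      have h1 := hgE t q hq htq
      have h2 : t ∈ E p → p = g t := hgE t p hp
      split_ifs <;> simp <;> grind
    · push Not at ht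
      have h1 := hg0 t ht
      have h2 := ht p hp
      split_ifs <;> simp <;> grind
  have hgm : Measurable g := by
    have hU : MeasurableSet (⋃ q ∈ s, E q) := Finset.measurableSet_biUnion s fun q _ => hE q
    intro T _
    have : g ⁻¹' T = ⋃ p ∈ s.filter (· ∈ T), g ⁻¹' {p} := by
      ext t
      simp [hgs t]
    rw [this]
    refine Finset.measurableSet_biUnion _ fun p hp => ?_
    rw [hfib p (Finset.mem_filter.1 hp).1]
    refine (hE p).union ?_
    split_ifs
    · exact hU.compl
    · exact .empty
  have hcover : ∀ᵐ t ∂μ, t ∈ ⋃ p ∈ s, E p := by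
    refine (mem_ae_iff_prob_eq_one (Finset.measurableSet_biUnion s fun q _ => hE q)).2 ?_
    rw [measure_biUnion_finset hd fun p _ => hE p, Finset.sum_congr rfl hEr,
      sum_measure_singleton, hs]
  have : IsProbabilityMeasure (μ.map g) := Measure.isProbabilityMeasure_map hgm.aemeasurable
  refine ⟨g, hgm, hgs, ?_, Eq.symm (Measure.eq_of_le_of_isProbabilityMeasure ?_)⟩
  · filter_upwards [hcover, hh.ae_eq_mk] with t ht hmk
    simp only [mem_iUnion] at ht
    obtain ⟨p, hp, htp⟩ := ht
    rw [hmk, ← hgE t p hp htp]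
    exact hsub p htp
  · refine Measure.le_iff.2 fun T hT => ?_
    have hsae : ∀ᵐ p ∂ρ, p ∈ (s : Set α) := (mem_ae_iff_prob_eq_one s.measurableSet).2 hs
    calc ρ T = ρ (s.filter (· ∈ T)) := by
          refine measure_congr ?_
          filter_upwards [hsae] with p hp
          have hp : p ∈ s := hp
          exact propext ⟨fun h => Finset.mem_filter.2 ⟨hp, h⟩, fun h => (Finset.mem_filter.1 h).2⟩
      _ = ∑ p ∈ s with p ∈ T, μ (E p) := by
          rw [← sum_measure_singleton]
          exact Finset.sum_congr rfl fun p hp => (hEr p (Finset.mem_filter.1 hp).1).symm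
      _ ≤ ∑ p ∈ s with p ∈ T, μ.map g {p} := by
          refine Finset.sum_le_sum fun p hp => ?_
          rw [Measure.map_apply hgm (measurableSet_singleton p)]
          exact measure_mono fun t ht => (hgE t p (Finset.mem_filter.1 hp).1 ht).symm
      _ = μ.map g (s.filter (· ∈ T)) := sum_measure_singleton
      _ ≤ μ.map g T := measure_mono fun p hp => (Finset.mem_filter.1 hp).2

theorem equiMeas_iff_map {u v : ℝ → ℝ} (hu : AEMeasurable u (volume.restrict (Ioo 0 1)))
    (hv : AEMeasurable v (volume.restrict (Ioo 0 1))) :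
    EquiMeas u v ↔ ∀ a, 0 < a → (volume.restrict (Ioo 0 1)).map u (Ioi a) =
      (volume.restrict (Ioo 0 1)).map v (Ioi a) := by
  have key : ∀ {w : ℝ → ℝ}, AEMeasurable w (volume.restrict (Ioo 0 1)) → ∀ a,
      (volume.restrict (Ioo 0 1)).map w (Ioi a) = volume {t | t ∈ Ioo (0 : ℝ) 1 ∧ a < w t} :=
    fun {w} hw a => by
      rw [Measure.map_apply_of_aemeasurable hw measurableSet_Ioi,
        Measure.restrict_apply' measurableSet_Ioo, inter_comm]
      rfl
  simp only [EquiMeas, key hu, key hv]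

/-- Probability measures on `[0, ∞)` are determined by their tails at positive levels. -/
theorem measure_ext_of_Ioi_pos {ρ σ : Measure ℝ} [IsProbabilityMeasure ρ] [IsProbabilityMeasure σ]
    (hρ : ρ (Iio 0) = 0) (hσ : σ (Iio 0) = 0) (h : ∀ a, 0 < a → ρ (Ioi a) = σ (Ioi a)) :
    ρ = σ := by
  have hpos : ∀ a, 0 < a → ProbabilityTheory.cdf ρ a = ProbabilityTheory.cdf σ a := fun a ha => by
    rw [ProbabilityTheory.cdf_eq_real, ProbabilityTheory.cdf_eq_real, ← compl_Ioi,
      probReal_compl_eq_one_sub measurableSet_Ioi, probReal_compl_eq_one_sub measurableSet_Ioi,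
      measureReal_def, measureReal_def, h a ha]
  refine Measure.eq_of_cdf ρ σ (StieltjesFunction.ext fun a => ?_)
  rcases lt_trichotomy a 0 with ha | rfl | ha
  · have hsub : Iic a ⊆ Iio 0 := fun x hx => lt_of_le_of_lt hx ha
    simp [ProbabilityTheory.cdf_eq_real, measureReal_def, measure_mono_null hsub hρ,
      measure_mono_null hsub hσ]
  · have hlim : ∀ τ : Measure ℝ, Tendsto (ProbabilityTheory.cdf τ) (nhdsWithin 0 (Ioi 0))
        (nhds (ProbabilityTheory.cdf τ 0)) := fun τ =>
      ((ProbabilityTheory.cdf τ).right_continuous 0).mono Ioi_subset_Ici_self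
    refine tendsto_nhds_unique (hlim ρ) ((hlim σ).congr' ?_)
    filter_upwards [self_mem_nhdsWithin] with a ha using (hpos a ha).symm
  · exact hpos a ha

/-- Any nonnegative measurable function `h` equimeasurable with the sum `u + v` of two
nonnegative simple functions decomposes (a.e.) as `h = h_u + h_v` with `h_u ∼ u`, `h_v ∼ v`
nonnegative simple functions. -/
theorem equimeasurable_sum_decomposition
    (u v h : ℝ → ℝ)
    (hu : IsSimpleOn u) (hu0 : ∀ t ∈ Set.Ioo (0:ℝ) 1, 0 ≤ u t)
    (hv : IsSimpleOn v) (hv0 : ∀ t ∈ Set.Ioo (0:ℝ) 1, 0 ≤ v t)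
    (hhmeas : AEMeasurable h (MeasureTheory.volume.restrict (Set.Ioo (0:ℝ) 1)))
    (hh0 : ∀ t ∈ Set.Ioo (0:ℝ) 1, 0 ≤ h t)
    (hequi : EquiMeas h (fun t => u t + v t)) :
    ∃ hu' hv' : ℝ → ℝ,
      IsSimpleOn hu' ∧ (∀ t ∈ Set.Ioo (0:ℝ) 1, 0 ≤ hu' t) ∧
      IsSimpleOn hv' ∧ (∀ t ∈ Set.Ioo (0:ℝ) 1, 0 ≤ hv' t) ∧
      (∀ᵐ t ∂(MeasureTheory.volume.restrict (Set.Ioo (0:ℝ) 1)), h t = hu' t + hv' t) ∧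
      EquiMeas hu' u ∧ EquiMeas hv' v := by
  classical
  set μ : Measure ℝ := volume.restrict (Ioo 0 1) with hμ
  have : IsProbabilityMeasure μ := ⟨by simp [hμ]⟩
  have hI : ∀ᵐ t ∂μ, t ∈ Ioo (0 : ℝ) 1 := ae_restrict_mem measurableSet_Ioo
  have hW : AEMeasurable (fun t => (u t, v t)) μ := hu.1.prodMk hv.1
  have hadd : Measurable fun p : ℝ × ℝ => p.1 + p.2 := measurable_fst.add measurable_snd
  have hρ : IsProbabilityMeasure (μ.map fun t => (u t, v t)) := Measure.isProbabilityMeasure_map hW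
  have hnonneg : ∀ w : ℝ → ℝ, AEMeasurable w μ → (∀ t ∈ Ioo (0 : ℝ) 1, 0 ≤ w t) →
      μ.map w (Iio 0) = 0 := fun w hw hw0 => by
    rw [Measure.map_apply_of_aemeasurable hw measurableSet_Iio, measure_eq_zero_iff_ae_notMem]
    filter_upwards [hI] with t ht using not_lt.2 (hw0 t ht)
  have hlaw : μ.map h = (μ.map fun t => (u t, v t)).map fun p => p.1 + p.2 := by
    have hsum : AEMeasurable (fun t => u t + v t) μ := hu.1.add hv.1
    have := Measure.isProbabilityMeasure_map hhmeas
    have := Measure.isProbabilityMeasure_map hsum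
    rw [AEMeasurable.map_map_of_aemeasurable hadd.aemeasurable hW]
    change _ = μ.map fun t => u t + v t
    exact measure_ext_of_Ioi_pos (hnonneg h hhmeas hh0)
      (hnonneg _ hsum fun t ht => add_nonneg (hu0 t ht) (hv0 t ht))
      ((equiMeas_iff_map hhmeas hsum).1 hequi)
  have hs : (μ.map fun t => (u t, v t)) ↑(hu.2.toFinset ×ˢ hv.2.toFinset) = 1 := by
    rw [Measure.map_apply_of_aemeasurable hW (Finset.measurableSet _),
      ← mem_ae_iff_prob_eq_one₀ (hW.nullMeasurable (Finset.measurableSet _))]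
    filter_upwards [hI] with t ht
    simpa using ⟨⟨t, ht, rfl⟩, ⟨t, ht, rfl⟩⟩
  obtain ⟨g, hg, hgs, hgh, hgρ⟩ := exists_measurable_mem_finset_map_eq hadd hhmeas hlaw _ hs
  simp only [Finset.mem_product, Finite.mem_toFinset] at hgs
  have h1 : AEMeasurable (fun t => (g t).1) μ := hg.fst.aemeasurable
  have h2 : AEMeasurable (fun t => (g t).2) μ := hg.snd.aemeasurable
  refine ⟨fun t => (g t).1, fun t => (g t).2,
    ⟨h1, hu.2.subset (image_subset_iff.2 fun t _ => (hgs t).1)⟩, fun t _ => ?_,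
    ⟨h2, hv.2.subset (image_subset_iff.2 fun t _ => (hgs t).2)⟩, fun t _ => ?_, hgh,
    (equiMeas_iff_map h1 hu.1).2 fun a _ => ?_, (equiMeas_iff_map h2 hv.1).2 fun a _ => ?_⟩
  · obtain ⟨x, hx, hxt⟩ := (hgs t).1
    exact (hu0 x hx).trans_eq hxt
  · obtain ⟨x, hx, hxt⟩ := (hgs t).2
    exact (hv0 x hx).trans_eq hxt
  · have := congrArg (fun ρ => ρ.map Prod.fst) hgρ
    rw [Measure.map_map measurable_fst hg,
      AEMeasurable.map_map_of_aemeasurable measurable_fst.aemeasurable hW] at this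
    exact congrArg (fun ρ : Measure ℝ => ρ (Ioi a)) this
  · have := congrArg (fun ρ => ρ.map Prod.snd) hgρ
    rw [Measure.map_map measurable_snd hg,
      AEMeasurable.map_map_of_aemeasurable measurable_snd.aemeasurable hW] at this
    exact congrArg (fun ρ : Measure ℝ => ρ (Ioi a)) this
end
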